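/- Let N ≥ 3, p ∈ (N/(N-2), p_c), and let V : ℝ^N\{0} → ℝ be locally Hölder continuous, radially symmetric and decreasing with respect to |x|, with 0 ≤ V ≤ 1, |V(x)-1| ≤ c₀|x|^{τ₀} for 0 < |x| ≤ 1 (some c₀ > 0, τ₀ > 0), and (1/γ)|x|^α ≤ V(x) ≤ γ|x|^α for |x| > 1, where γ > 1 and (N-2)p_c - N - 2 < α ≤ 0. Then for every R > 0 there exists a constant c > 0, independent of ν, such that for every ν > 0 and every ν-fast decaying solution u_ν of -Δu = V u^p on ℝ^N\{0} with lim_{|x|→0} u_ν(x)|x|^{2/(p-1)} = c_p, one has ∫_{B_R(0)} u_ν(x) dx ≤ c and ∫_{B_R(0)} V(x) u_ν(x)^p dx ≤ c. -/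

import Mathlib

open Real MeasureTheory Filter Metric Set

noncomputable section

/-- The Euclidean Laplacian, as the sum of second directional derivatives along the
coordinate axes. -/
def lap {N : ℕ} (u : EuclideanSpace ℝ (Fin N) → ℝ) (x : EuclideanSpace ℝ (Fin N)) : ℝ :=
  ∑ i : Fin N,
    fderiv ℝ (fun y => fderiv ℝ u y (EuclideanSpace.single i (1:ℝ))) x
      (EuclideanSpace.single i (1:ℝ))

/-- `f` is locally Hölder continuous on `s`. -/
def LocHolderOn {N : ℕ} (f : EuclideanSpace ℝ (Fin N) → ℝ)
    (s : Set (EuclideanSpace ℝ (Fin N))) : Prop :=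
  ∀ x ∈ s, ∃ (C α : NNReal) (r : ℝ), 0 < r ∧ 0 < α ∧ α ≤ 1 ∧
    HolderOnWith C α f (Metric.ball x r ∩ s)

/-- The constant `c_p = ((2/(p-1))(N-2-2/(p-1)))^{1/(p-1)}`. -/
def cp (N : ℕ) (p : ℝ) : ℝ := (2 / (p - 1) * ((N:ℝ) - 2 - 2 / (p - 1))) ^ (1 / (p - 1))

/-- The Joseph–Lundgren exponent `p_c = 1 + 4/(N-4+2√(N-1))`. -/
def pc (N : ℕ) : ℝ := 1 + 4 / ((N:ℝ) - 4 + 2 * Real.sqrt ((N:ℝ) - 1))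

/-- The exponent `τ_p^*`. -/
def tauStar (N : ℕ) (p : ℝ) : ℝ :=
  (2 / (p - 1) - ((N:ℝ) - 2) / 2) -
    Real.sqrt ((2 / (p - 1) - ((N:ℝ) - 2) / 2) ^ 2 - 2 * ((N:ℝ) - 2 - 2 / (p - 1)))

/-- The surface measure `σ_{N-1}` of the unit sphere in `ℝ^N`,
expressed as `N` times the volume of the unit ball. -/
def sphereArea (N : ℕ) : ℝ :=
  (N : ℝ) * (volume (Metric.ball (0 : EuclideanSpace ℝ (Fin N)) 1)).toReal

/-- The normalizing constant `c_N = 1/((N-2)σ_{N-1})` of the fundamental solution of `-Δ`. -/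
def cGreen (N : ℕ) : ℝ := 1 / (((N:ℝ) - 2) * sphereArea N)

/-- `u` is a `ν`-fast decaying solution of `-Δ u = V u^p` in `ℝ^N \ {0}`. -/
def FastDecaySol (N : ℕ) (p : ℝ) (V u : EuclideanSpace ℝ (Fin N) → ℝ) (ν : ℝ) : Prop :=
  ContDiffOn ℝ 2 u {0}ᶜ ∧ (∀ x : EuclideanSpace ℝ (Fin N), x ≠ 0 → 0 < u x) ∧
  (∀ x : EuclideanSpace ℝ (Fin N), x ≠ 0 → -lap u x = V x * u x ^ p) ∧
  Tendsto (fun x : EuclideanSpace ℝ (Fin N) => u x * ‖x‖ ^ ((N:ℝ) - 2))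
    (Filter.comap (fun x => ‖x‖) Filter.atTop) (nhds ν)

/-- `u(x)|x|^{2/(p-1)} → c_p` as `x → 0`. -/
def SingAtOrigin (N : ℕ) (p : ℝ) (u : EuclideanSpace ℝ (Fin N) → ℝ) : Prop :=
  Tendsto (fun x : EuclideanSpace ℝ (Fin N) => u x * ‖x‖ ^ (2 / (p - 1)))
    (nhdsWithin 0 {0}ᶜ) (nhds (cp N p))

/-- Condition `(V₀)` with parameters `c₀, τ₀, c_∞, β`. -/
def V0cond (N : ℕ) (V : EuclideanSpace ℝ (Fin N) → ℝ) (c₀ τ₀ cinf β : ℝ) : Prop :=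
  LocHolderOn V {0}ᶜ ∧ 0 < c₀ ∧ 0 < τ₀ ∧
  (∀ x : EuclideanSpace ℝ (Fin N), x ≠ 0 → ‖x‖ ≤ 1 → |V x - 1| ≤ c₀ * ‖x‖ ^ τ₀) ∧
  1 ≤ cinf ∧
  ∀ x : EuclideanSpace ℝ (Fin N), x ≠ 0 → 0 ≤ V x ∧ V x ≤ cinf * (1 + ‖x‖) ^ β

/-- The partial derivative in direction `i`. -/
def pd {N : ℕ} (i : Fin N) (u : EuclideanSpace ℝ (Fin N) → ℝ) (x : EuclideanSpace ℝ (Fin N)) : ℝ :=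
  fderiv ℝ u x (EuclideanSpace.single i (1:ℝ))

theorem lap_eq_pd {N : ℕ} (u : EuclideanSpace ℝ (Fin N) → ℝ) (x : EuclideanSpace ℝ (Fin N)) :
    lap u x = ∑ i : Fin N, pd i (pd i u) x := rfl

theorem pd_contDiff {N : ℕ} (i : Fin N) {u : EuclideanSpace ℝ (Fin N) → ℝ} {n m : ℕ∞}
    (hu : ContDiff ℝ n u) (h : m + 1 ≤ n) : ContDiff ℝ m (pd i u) := by
  have : ContDiff ℝ m (fderiv ℝ u) := hu.fderiv_right (by exact_mod_cast h)
  exact this.clm_apply contDiff_const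

theorem pd_compact {N : ℕ} (i : Fin N) {u : EuclideanSpace ℝ (Fin N) → ℝ}
    (hu : HasCompactSupport u) : HasCompactSupport (pd i u) :=
  hu.fderiv_apply (𝕜 := ℝ) _

theorem pd_congr {N : ℕ} (i : Fin N) {u w : EuclideanSpace ℝ (Fin N) → ℝ}
    {x : EuclideanSpace ℝ (Fin N)} (h : u =ᶠ[nhds x] w) : pd i u =ᶠ[nhds x] pd i w := by
  filter_upwards [h.fderiv (𝕜 := ℝ)] with y hy
  simp [pd, hy]

theorem lap_congr {N : ℕ} {u w : EuclideanSpace ℝ (Fin N) → ℝ}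
    {x : EuclideanSpace ℝ (Fin N)} (h : u =ᶠ[nhds x] w) : lap u x = lap w x := by
  rw [lap_eq_pd, lap_eq_pd]
  exact Finset.sum_congr rfl fun i _ => (pd_congr i (pd_congr i h)).self_of_nhds

theorem lap_const {N : ℕ} (c : ℝ) (x : EuclideanSpace ℝ (Fin N)) :
    lap (fun _ => c) x = 0 := by
  simp [lap]

theorem lap_continuous {N : ℕ} {u : EuclideanSpace ℝ (Fin N) → ℝ} (hu : ContDiff ℝ 2 u) :
    Continuous (lap u) := by
  have : lap u = fun x => ∑ i : Fin N, pd i (pd i u) x := rfl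
  rw [this]
  refine continuous_finsetSum _ fun i _ => ?_
  have h1 : ContDiff ℝ (1 : ℕ∞) (pd i u) := pd_contDiff i (n := 2) (by exact_mod_cast hu) (by norm_num)
  exact (pd_contDiff i (n := 1) (m := 0) h1 (by norm_num)).continuous

theorem lap_compact {N : ℕ} {u : EuclideanSpace ℝ (Fin N) → ℝ} (hu : HasCompactSupport u) :
    HasCompactSupport (lap u) := by
  refine HasCompactSupport.intro (K := tsupport u) hu fun x hx => ?_
  rw [lap_congr (notMem_tsupport_iff_eventuallyEq.1 hx)]
  exact lap_const 0 x

theorem lap_sub {N : ℕ} {u w : EuclideanSpace ℝ (Fin N) → ℝ} (hu : ContDiff ℝ 2 u)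
    (hw : ContDiff ℝ 2 w) (x : EuclideanSpace ℝ (Fin N)) :
    lap (fun y => u y - w y) x = lap u x - lap w x := by
  simp only [lap_eq_pd, ← Finset.sum_sub_distrib]
  refine Finset.sum_congr rfl fun i _ => ?_
  have h1 : ContDiff ℝ (1 : ℕ∞) (pd i u) := pd_contDiff i (n := 2) (by exact_mod_cast hu) (by norm_num)
  have h2 : ContDiff ℝ (1 : ℕ∞) (pd i w) := pd_contDiff i (n := 2) (by exact_mod_cast hw) (by norm_num)
  have e : pd i (fun y => u y - w y) = fun y => pd i u y - pd i w y := by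
    funext y
    simp only [pd]
    rw [fderiv_fun_sub ((hu.differentiable (by norm_num)) y) ((hw.differentiable (by norm_num)) y)]
    simp
  rw [e]
  change fderiv ℝ _ _ _ = fderiv ℝ _ _ _ - fderiv ℝ _ _ _
  rw [fderiv_fun_sub ((h1.differentiable (by norm_num)) x) ((h2.differentiable (by norm_num)) x)]
  simp

theorem pd_smul {N : ℕ} (i : Fin N) (u : EuclideanSpace ℝ (Fin N) → ℝ) (c b : ℝ)
    (x : EuclideanSpace ℝ (Fin N)) :
    pd i (fun y => b * u (c • y)) x = b * c * pd i u (c • x) := by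
  have := fderiv_comp_smul (𝕜 := ℝ) (f := u) (x := x) c
  simp only [pd]
  have h2 : (fun y => b * u (c • y)) = b • (fun y => u (c • y)) := by
    funext y; simp
  rw [h2, fderiv_const_smul_field]
  have h3 : fderiv ℝ (fun y => u (c • y)) x = c • fderiv ℝ u (c • x) := this
  rw [Pi.smul_apply, h3]
  simp [mul_assoc]

theorem lap_smul {N : ℕ} (u : EuclideanSpace ℝ (Fin N) → ℝ) (c : ℝ)
    (x : EuclideanSpace ℝ (Fin N)) :
    lap (fun y => u (c • y)) x = c ^ 2 * lap u (c • x) := by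
  simp only [lap_eq_pd, Finset.mul_sum]
  refine Finset.sum_congr rfl fun i _ => ?_
  have e : pd i (fun y => u (c • y)) = fun y => c * pd i u (c • y) := by
    funext y
    have := pd_smul i u c 1 y
    simpa using this
  rw [e, pd_smul]; ring

theorem ibp_one {N : ℕ} (i : Fin N) {f g : EuclideanSpace ℝ (Fin N) → ℝ} (hf : ContDiff ℝ 1 f)
    (hg : ContDiff ℝ 1 g) (hc : HasCompactSupport f) :
    ∫ x, f x * pd i g x = - ∫ x, pd i f x * g x := by
  have cf : Continuous (pd i f) :=
    (pd_contDiff i (n := 1) (m := 0) (by exact_mod_cast hf) (by norm_num)).continuous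
  have cg : Continuous (pd i g) :=
    (pd_contDiff i (n := 1) (m := 0) (by exact_mod_cast hg) (by norm_num)).continuous
  refine integral_mul_fderiv_eq_neg_fderiv_mul_of_integrable ?_ ?_ ?_
    (fun x _ => (hf.differentiable (by norm_num)) x) (fun x _ => (hg.differentiable (by norm_num)) x)
  · exact (cf.mul hg.continuous).integrable_of_hasCompactSupport ((pd_compact i hc).mul_right)
  · exact (hf.continuous.mul cg).integrable_of_hasCompactSupport (hc.mul_right)
  · exact (hf.continuous.mul hg.continuous).integrable_of_hasCompactSupport (hc.mul_right)

theorem ibp_lap {N : ℕ} {f g : EuclideanSpace ℝ (Fin N) → ℝ} (hf : ContDiff ℝ 2 f)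
    (hg : ContDiff ℝ 2 g) (hc : HasCompactSupport f) :
    ∫ x, f x * lap g x = ∫ x, g x * lap f x := by
  simp only [lap_eq_pd, Finset.mul_sum]
  have h1 : ∀ i, ContDiff ℝ (1 : ℕ∞) (pd i f) := fun i =>
    pd_contDiff i (n := 2) (by exact_mod_cast hf) (by norm_num)
  have h2 : ∀ i, ContDiff ℝ (1 : ℕ∞) (pd i g) := fun i =>
    pd_contDiff i (n := 2) (by exact_mod_cast hg) (by norm_num)
  have k1 : ∀ i, Continuous (pd i (pd i f)) := fun i =>
    (pd_contDiff i (n := 1) (m := 0) (h1 i) (by norm_num)).continuous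
  have k2 : ∀ i, Continuous (pd i (pd i g)) := fun i =>
    (pd_contDiff i (n := 1) (m := 0) (h2 i) (by norm_num)).continuous
  rw [integral_finsetSum, integral_finsetSum]
  · refine Finset.sum_congr rfl fun i _ => ?_
    rw [ibp_one i (hf.of_le (by norm_num)) (h2 i) hc]
    have := ibp_one i (h1 i) (hg.of_le (by norm_num)) (pd_compact i hc)
    rw [this, neg_neg]
    exact integral_congr_ae (ae_of_all _ fun x => mul_comm _ _)
  · intro i _
    exact (hg.continuous.mul (k1 i)).integrable_of_hasCompactSupport
      ((pd_compact i (pd_compact i hc)).mul_left)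
  · intro i _
    exact (hf.continuous.mul (k2 i)).integrable_of_hasCompactSupport (hc.mul_right)

theorem lap_pow_bound {N : ℕ} {f : EuclideanSpace ℝ (Fin N) → ℝ} (hf : ContDiff ℝ 2 f)
    (hc : HasCompactSupport f) (h0 : ∀ x, 0 ≤ f x) (k : ℕ) :
    ∃ M : ℝ, 0 < M ∧ ∀ x, |lap (fun y => f y ^ (k + 2)) x| ≤ M * f x ^ k := by
  have h1 : ∀ i, ContDiff ℝ (1 : ℕ∞) (pd i f) := fun i =>
    pd_contDiff i (n := 2) (by exact_mod_cast hf) (by norm_num)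
  have k1 : ∀ i, Continuous (pd i (pd i f)) := fun i =>
    (pd_contDiff i (n := 1) (m := 0) (h1 i) (by norm_num)).continuous
  have hd := hf.differentiable (by norm_num)
  have e1 : ∀ i, pd i (fun y => f y ^ (k + 2)) = fun y => ((k:ℝ) + 2) * (f y ^ (k + 1) * pd i f y) := by
    intro i
    funext y
    have := ((hd y).hasFDerivAt.pow (k + 2)).fderiv
    simp only [pd]
    erw [this]
    simp
    ring
  have e2 : ∀ i x, pd i (pd i (fun y => f y ^ (k + 2))) x =
      f x ^ k * (((k:ℝ) + 2) * ((k + 1) * (pd i f x) ^ 2 + f x * pd i (pd i f) x)) := by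
    intro i x
    rw [e1]
    have a := ((hd x).hasFDerivAt.pow (k + 1)).mul (((h1 i).differentiable (by norm_num) x).hasFDerivAt)
    have b := (a.const_mul ((k:ℝ) + 2)).fderiv
    change fderiv ℝ _ _ _ = _
    erw [b]
    simp [pd]
    ring
  set G : EuclideanSpace ℝ (Fin N) → ℝ := fun x =>
    ∑ i, (((k:ℝ) + 2) * ((k + 1) * (pd i f x) ^ 2 + f x * pd i (pd i f) x)) with hG
  have hGc : Continuous G := by
    refine continuous_finsetSum _ fun i _ => ?_
    have := (h1 i).continuous
    have := k1 i
    have := hf.continuous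
    fun_prop
  have hGs : HasCompactSupport G := by
    refine HasCompactSupport.intro (K := tsupport f) hc fun x hx => ?_
    have hx' := notMem_tsupport_iff_eventuallyEq.1 hx
    have z : f x = 0 := hx'.self_of_nhds
    have z1 : ∀ i, pd i f x = 0 := fun i => by
      rw [(pd_congr i hx').self_of_nhds]
      change fderiv ℝ (fun _ => (0:ℝ)) _ _ = 0
      simp
    simp [hG, z, z1]
  obtain ⟨M, hM⟩ := hGc.bounded_above_of_compact_support hGs
  refine ⟨|M| + 1, by positivity, fun x => ?_⟩
  have : lap (fun y => f y ^ (k + 2)) x = f x ^ k * G x := by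
    rw [lap_eq_pd, hG, Finset.mul_sum]
    exact Finset.sum_congr rfl fun i _ => e2 i x
  rw [this, abs_mul, abs_of_nonneg (pow_nonneg (h0 x) k), mul_comm]
  gcongr
  · exact pow_nonneg (h0 x) k
  · have := hM x
    rw [Real.norm_eq_abs] at this
    linarith [le_abs_self M]

/-- Young type inequality. -/
theorem young_aux (p M κ : ℝ) (hp : 1 < p) (hM : 0 < M) (hκ : 0 < κ) :
    ∃ C : ℝ, 0 < C ∧ ∀ t : ℝ, 0 ≤ t → M * t ≤ κ * t ^ p + C := by
  set T := (M / κ) ^ (1 / (p - 1)) with hT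
  have hTp : 0 < T := by positivity
  refine ⟨M * T, by positivity, fun t ht => ?_⟩
  rcases le_total t T with h | h
  · have : 0 ≤ κ * t ^ p := by positivity
    nlinarith
  · have htp : 0 < t := hTp.trans_le h
    have h1 : M / κ ≤ t ^ (p - 1) := by
      calc M / κ = T ^ (p - 1) := by
            rw [hT, ← Real.rpow_mul (by positivity), one_div_mul_cancel (by linarith), Real.rpow_one]
        _ ≤ t ^ (p - 1) := by gcongr
    have h2 : t ^ p = t ^ (p - 1) * t := by
      rw [← Real.rpow_add_one htp.ne']; congr 1; ring
    have h3 : M ≤ κ * t ^ (p - 1) := by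
      rw [div_le_iff₀ hκ] at h1; linarith
    rw [h2]
    have : 0 < M * T := by positivity
    nlinarith

/-- passing to the limit in the exhaustion of the punctured ball -/
theorem limit_aux {N : ℕ} (hN : 3 ≤ N) (f : EuclideanSpace ℝ (Fin N) → ℝ) (R c : ℝ) (hc : 0 ≤ c)
    (h : ∀ᶠ ε in nhdsWithin (0:ℝ) (Ioi 0),
      ∫ x in Metric.ball (0 : EuclideanSpace ℝ (Fin N)) R \ closedBall 0 (2 * ε), f x ≤ c) :
    ∫ x in Metric.ball (0 : EuclideanSpace ℝ (Fin N)) R, f x ≤ c := by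
  have : Nonempty (Fin N) := ⟨⟨0, by omega⟩⟩
  have : Nontrivial (EuclideanSpace ℝ (Fin N)) := by
    have : Nontrivial (Fin N → ℝ) := Function.nontrivial
    exact (WithLp.equiv 2 (Fin N → ℝ)).nontrivial
  by_cases hf : IntegrableOn f (Metric.ball (0 : EuclideanSpace ℝ (Fin N)) R)
  swap
  · rw [integral_undef hf]; exact hc
  set s : ℕ → Set (EuclideanSpace ℝ (Fin N)) := fun n =>
    Metric.ball 0 R \ closedBall 0 (2 * (1 / ((n:ℝ) + 1))) with hs
  have hu : (⋃ n, s n) = Metric.ball 0 R \ {0} := by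
    ext x
    simp only [hs, mem_iUnion, Set.mem_sdiff, mem_closedBall, dist_zero_right, not_le, mem_singleton_iff]
    constructor
    · rintro ⟨n, h1, h2⟩
      refine ⟨h1, ?_⟩
      rintro rfl
      rw [norm_zero] at h2
      have : 0 < 2 * (1 / ((n:ℝ) + 1)) := by positivity
      linarith
    · rintro ⟨h1, h2⟩
      obtain ⟨n, hn⟩ := exists_nat_one_div_lt (half_pos (norm_pos_iff.2 h2))
      exact ⟨n, h1, by linarith⟩
  have ht := tendsto_setIntegral_of_monotone (μ := volume) (f := f) (s := s)
    (fun n => measurableSet_ball.diff measurableSet_closedBall)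
    (by
      intro m n hmn
      apply sdiff_subset_sdiff_right
      apply closedBall_subset_closedBall
      gcongr)
    (by rw [hu]; exact hf.mono_set sdiff_subset)
  rw [hu] at ht
  have e : ∫ x in Metric.ball (0 : EuclideanSpace ℝ (Fin N)) R \ {0}, f x =
      ∫ x in Metric.ball (0 : EuclideanSpace ℝ (Fin N)) R, f x := by
    apply setIntegral_congr_set
    exact sdiff_null_ae_eq_self (measure_singleton _)
  rw [e] at ht
  have hl : Tendsto (fun n : ℕ => 1 / ((n:ℝ) + 1)) atTop (nhdsWithin (0:ℝ) (Ioi 0)) :=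
    tendsto_nhdsWithin_iff.2 ⟨tendsto_one_div_add_atTop_nhds_zero_nat,
      Eventually.of_forall fun n => by simp only [mem_Ioi]; positivity⟩
  exact le_of_tendsto ht (hl.eventually h)

theorem core {N : ℕ} (p R κ M C K Mχ ε : ℝ) (k : ℕ) (V u φ χ : EuclideanSpace ℝ (Fin N) → ℝ)
    (hp : 1 < p) (hR : 0 < R) (hC : 0 < C) (hM : 0 < M) (hMχ : 0 < Mχ) (hK : 0 < K)
    (hφ : ContDiff ℝ 2 φ) (hφs : tsupport φ ⊆ closedBall 0 (2 * R))
    (hφ1 : ∀ x, ‖x‖ ≤ R → φ x = 1) (hφ0 : ∀ x, 0 ≤ φ x) (hφle : ∀ x, φ x ≤ 1)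
    (hlap : ∀ x, |lap (fun y => φ y ^ (k + 2)) x| ≤ M * φ x ^ k)
    (hk : (k:ℝ) + 2 ≤ p * k)
    (hy : ∀ t : ℝ, 0 ≤ t → M * t ≤ κ / 2 * t ^ p + C)
    (hχ : ContDiff ℝ 2 χ) (hχs : tsupport χ ⊆ closedBall 0 2)
    (hχ1 : ∀ x, ‖x‖ ≤ 1 → χ x = 1) (hχ0 : ∀ x, 0 ≤ χ x) (hχle : ∀ x, χ x ≤ 1)
    (hχlap : ∀ x, |lap χ x| ≤ Mχ)
    (hV : ∀ x, x ≠ 0 → ‖x‖ ≤ 2 * R → κ ≤ V x) (hV0 : ∀ x, x ≠ 0 → 0 ≤ V x)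
    (hu : ContDiffOn ℝ 2 u {0}ᶜ) (hup : ∀ x, x ≠ 0 → 0 < u x)
    (heq : ∀ x, x ≠ 0 → -lap u x = V x * u x ^ p)
    (hε : 0 < ε) (hεR : 2 * ε < R) (huK : ∀ x, ε ≤ ‖x‖ → ‖x‖ ≤ 2 * ε → u x ≤ K) :
    IntegrableOn u (Metric.ball 0 R \ closedBall 0 (2 * ε)) ∧
    IntegrableOn (fun x => V x * u x ^ p) (Metric.ball 0 R \ closedBall 0 (2 * ε)) ∧
    ∫ x in Metric.ball 0 R \ closedBall 0 (2 * ε), V x * u x ^ p ≤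
      2 * (C * volume.real (closedBall (0 : EuclideanSpace ℝ (Fin N)) (2 * R)) +
        K * (Mχ * ε⁻¹ ^ 2) * volume.real (closedBall (0 : EuclideanSpace ℝ (Fin N)) (2 * ε))) := by
  -- vanishing of `χ` outside a ball, and locally
  have hχout : ∀ x, 2 < ‖x‖ → χ =ᶠ[nhds x] 0 := fun x hx =>
    notMem_tsupport_iff_eventuallyEq.1 fun h => by
      have := hχs h
      rw [mem_closedBall, dist_zero_right] at this
      linarith
  have hφout : ∀ x, 2 * R < ‖x‖ → φ =ᶠ[nhds x] 0 := fun x hx =>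
    notMem_tsupport_iff_eventuallyEq.1 fun h => by
      have := hφs h
      rw [mem_closedBall, dist_zero_right] at this
      linarith
  have nhlt : ∀ (x : EuclideanSpace ℝ (Fin N)) (r : ℝ), ‖x‖ < r → ∀ᶠ y in nhds x, ‖y‖ < r :=
    fun x r h => (continuous_norm.tendsto x).eventually (gt_mem_nhds h)
  have nhgt : ∀ (x : EuclideanSpace ℝ (Fin N)) (r : ℝ), r < ‖x‖ → ∀ᶠ y in nhds x, r < ‖y‖ :=
    fun x r h => (continuous_norm.tendsto x).eventually (lt_mem_nhds h)
  -- the regularized solution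
  set w : EuclideanSpace ℝ (Fin N) → ℝ := fun x => u x * (1 - χ ((4 / ε) • x)) with hw
  have hsm : ∀ (a : ℝ), 0 < a → ∀ x : EuclideanSpace ℝ (Fin N), ‖a • x‖ = a * ‖x‖ :=
    fun a ha x => by rw [norm_smul, Real.norm_of_nonneg ha.le]
  have hwu : ∀ x, ε / 2 < ‖x‖ → w x = u x := by
    intro x hx
    have : χ ((4 / ε) • x) = 0 := by
      refine (hχout _ ?_).self_of_nhds
      rw [hsm _ (by positivity), div_mul_eq_mul_div, lt_div_iff₀ hε]
      linarith
    simp [hw, this]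
  have hw2 : ContDiff ℝ 2 w := by
    rw [contDiff_iff_contDiffAt]
    intro x
    by_cases hx : x = 0
    · have : w =ᶠ[nhds x] fun _ => 0 := by
        filter_upwards [nhlt x (ε / 4) (by rw [hx, norm_zero]; positivity)] with y hy
        have : χ ((4 / ε) • y) = 1 := by
          refine hχ1 _ ?_
          rw [hsm _ (by positivity), div_mul_eq_mul_div, div_le_iff₀ hε]
          linarith
        simp [hw, this]
      exact contDiffAt_const.congr_of_eventuallyEq this
    · have h1 : ContDiffAt ℝ 2 u x := hu.contDiffAt (isOpen_compl_singleton.mem_nhds hx)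
      have h2 : ContDiff ℝ 2 (fun x : EuclideanSpace ℝ (Fin N) => 1 - χ ((4 / ε) • x)) :=
        contDiff_const.sub (hχ.comp (contDiff_const_smul _))
      exact h1.mul h2.contDiffAt
  have hwlap : ∀ x, ε / 2 < ‖x‖ → lap w x = lap u x := fun x hx =>
    lap_congr ((nhgt x _ hx).mono fun y hy => hwu y hy)
  have hne : ∀ x : EuclideanSpace ℝ (Fin N), ε / 2 < ‖x‖ → x ≠ 0 := by
    rintro x hx rfl
    rw [norm_zero] at hx
    linarith
  have hwlap' : ∀ x, ε / 2 < ‖x‖ → -lap w x = V x * u x ^ p := fun x hx => by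
    rw [hwlap x hx, heq x (hne x hx)]
  -- the test function
  set Φ : EuclideanSpace ℝ (Fin N) → ℝ := fun x => φ x ^ (k + 2) with hΦ
  set χε : EuclideanSpace ℝ (Fin N) → ℝ := fun x => χ (ε⁻¹ • x) with hχε
  set ψ : EuclideanSpace ℝ (Fin N) → ℝ := fun x => Φ x - χε x with hψ
  have hΦ2 : ContDiff ℝ 2 Φ := hφ.pow _
  have hχε2 : ContDiff ℝ 2 χε := hχ.comp (contDiff_const_smul _)
  have hψ2 : ContDiff ℝ 2 ψ := hΦ2.sub hχε2
  have hχεout : ∀ x, 2 * ε < ‖x‖ → χε x = 0 := fun x hx => by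
    refine (hχout _ ?_).self_of_nhds
    rw [hsm _ (by positivity), inv_mul_eq_div, lt_div_iff₀ hε]
    linarith
  have hχεin : ∀ x, ‖x‖ ≤ ε → χε x = 1 := fun x hx => by
    refine hχ1 _ ?_
    rw [hsm _ (by positivity), inv_mul_eq_div, div_le_iff₀ hε]
    linarith
  have hΦin : ∀ x, ‖x‖ ≤ R → Φ x = 1 := fun x hx => by simp [hΦ, hφ1 x hx]
  have hΦ0 : ∀ x, 0 ≤ Φ x := fun x => pow_nonneg (hφ0 x) _
  have hψ0 : ∀ x, 0 ≤ ψ x := fun x => by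
    rcases le_or_gt ‖x‖ R with h | h
    · have := hχle (ε⁻¹ • x)
      simp only [hψ, hΦin x h, hχε]
      linarith
    · simp only [hψ, hχεout x (by linarith)]
      linarith [hΦ0 x]
  have hψin : ∀ x, ‖x‖ ≤ ε → ψ x = 0 := fun x hx => by
    simp only [hψ, hΦin x (by linarith), hχεin x hx, sub_self]
  have hψc : HasCompactSupport ψ := by
    refine HasCompactSupport.intro (K := closedBall 0 (2 * R)) (isCompact_closedBall _ _) ?_
    intro x hx
    rw [mem_closedBall, dist_zero_right, not_le] at hx
    have : φ x = 0 := (hφout x hx).self_of_nhds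
    simp [hψ, hΦ, this, hχεout x (by linarith)]
  have hlapψ : ∀ x, lap ψ x = lap Φ x - lap χε x := fun x => lap_sub hΦ2 hχε2 x
  have hA : ∀ x, w x * lap χε x ≤
      (closedBall (0 : EuclideanSpace ℝ (Fin N)) (2 * ε)).indicator (fun _ => K * (Mχ * ε⁻¹ ^ 2)) x := by
    intro x
    have hpos : 0 ≤ (closedBall (0 : EuclideanSpace ℝ (Fin N)) (2 * ε)).indicator
        (fun _ => K * (Mχ * ε⁻¹ ^ 2)) x := indicator_nonneg (fun _ _ => by positivity) _
    rcases lt_or_ge ‖x‖ ε with h | h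
    · have : lap χε x = 0 := by
        rw [lap_congr (w := fun _ => 1) ((nhlt x ε h).mono fun y hy => hχεin y hy.le)]
        exact lap_const _ _
      rw [this, mul_zero]; exact hpos
    rcases lt_or_ge (2 * ε) ‖x‖ with h' | h'
    · have : lap χε x = 0 := by
        rw [lap_congr (w := fun _ => 0) ((nhgt x _ h').mono fun y hy => hχεout y hy)]
        exact lap_const _ _
      rw [this, mul_zero]; exact hpos
    rw [indicator_of_mem (by simpa using h'), hwu x (by linarith)]
    have h1 : |lap χε x| ≤ Mχ * ε⁻¹ ^ 2 := by
      rw [hχε, lap_smul, abs_mul, abs_of_nonneg (sq_nonneg _), mul_comm]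
      gcongr
      exact hχlap _
    have h2 := hup x (hne x (by linarith))
    calc u x * lap χε x ≤ u x * (Mχ * ε⁻¹ ^ 2) := by
          gcongr; exact (le_abs_self _).trans h1
      _ ≤ _ := by
          gcongr; exact huK x h h'
  have hnn : ∀ x, 0 ≤ ψ x * (-lap w x) := by
    intro x
    rcases le_or_gt ‖x‖ ε with h | h
    · rw [hψin x h, zero_mul]
    · have h3 := hne x (by linarith)
      rw [hwlap' x (by linarith)]
      have := hV0 x h3
      have := hup x h3
      have := hψ0 x
      positivity
  have hB : ∀ x, -(w x * lap Φ x) ≤ 1 / 2 * (ψ x * (-lap w x)) +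
      (closedBall (0 : EuclideanSpace ℝ (Fin N)) (2 * R)).indicator (fun _ => C) x := by
    intro x
    have hpos : 0 ≤ (closedBall (0 : EuclideanSpace ℝ (Fin N)) (2 * R)).indicator
        (fun _ => C) x := indicator_nonneg (fun _ _ => hC.le) _
    have hn := hnn x
    rcases lt_or_ge ‖x‖ R with h | h
    · have : lap Φ x = 0 := by
        rw [lap_congr (w := fun _ => 1) ((nhlt x R h).mono fun y hy => hΦin y hy.le)]
        exact lap_const _ _
      rw [this, mul_zero, neg_zero]; linarith
    rcases lt_or_ge (2 * R) ‖x‖ with h' | h'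
    · have : lap Φ x = 0 := by
        rw [lap_congr (w := fun _ => 0)
          ((hφout x h').mono fun y hy => by simp [hΦ, hy])]
        exact lap_const _ _
      rw [this, mul_zero, neg_zero]; linarith
    have hx0 := hne x (by linarith)
    have hux := hup x hx0
    rw [indicator_of_mem (by simpa using h'), hwu x (by linarith), hwlap' x (by linarith)]
    have hψx : ψ x = φ x ^ (k + 2) := by
      simp only [hψ, hΦ, hχεout x (by linarith), sub_zero]
    rw [hψx]
    set t := u x * φ x ^ k with ht
    have ht0 : 0 ≤ t := mul_nonneg hux.le (pow_nonneg (hφ0 x) _)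
    have h1 : -(u x * lap Φ x) ≤ M * t := by
      have := (neg_abs_le (lap Φ x))
      have h2 := hlap x
      have : -lap Φ x ≤ M * φ x ^ k := by linarith
      calc -(u x * lap Φ x) = u x * (-lap Φ x) := by ring
        _ ≤ u x * (M * φ x ^ k) := by gcongr
        _ = M * t := by rw [ht]; ring
    have h2 : t ^ p ≤ u x ^ p * φ x ^ (k + 2) := by
      rw [ht, Real.mul_rpow hux.le (pow_nonneg (hφ0 x) _)]
      gcongr
      rw [← Real.rpow_natCast, ← Real.rpow_natCast, ← Real.rpow_mul (hφ0 x)]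
      refine Real.rpow_le_rpow_of_exponent_ge_of_imp (hφ0 x) (hφle x) ?_ ?_
      · push_cast; linarith
      · intro _ h0
        push_cast at h0
        have : (0:ℝ) ≤ k := Nat.cast_nonneg k
        nlinarith
    have h3 := hy t ht0
    have h4 := hV x hx0 h'
    have h5 : 0 ≤ u x ^ p * φ x ^ (k + 2) :=
      mul_nonneg (Real.rpow_nonneg hux.le _) (pow_nonneg (hφ0 x) _)
    have h6 := hV0 x hx0
    have h7 : 0 ≤ t ^ p := Real.rpow_nonneg ht0 _
    have h8 : κ * t ^ p ≤ V x * (u x ^ p * φ x ^ (k + 2)) :=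
      (mul_le_mul_of_nonneg_right h4 h7).trans (mul_le_mul_of_nonneg_left h2 h6)
    calc -(u x * lap Φ x) ≤ κ / 2 * t ^ p + C := h1.trans h3
      _ ≤ _ := by linarith
  have hIntg : Integrable (fun x => ψ x * (-lap w x)) :=
    (hψ2.continuous.mul (lap_continuous hw2).neg).integrable_of_hasCompactSupport hψc.mul_right
  have hmain : ∫ x, ψ x * (-lap w x) ≤ ∫ x, (1 / 2 * (ψ x * (-lap w x)) +
      (closedBall (0 : EuclideanSpace ℝ (Fin N)) (2 * R)).indicator (fun _ => C) x +
      (closedBall (0 : EuclideanSpace ℝ (Fin N)) (2 * ε)).indicator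
        (fun _ => K * (Mχ * ε⁻¹ ^ 2)) x) := by
    have e : ∫ x, ψ x * (-lap w x) = ∫ x, w x * (-lap ψ x) := by
      simp only [mul_neg, integral_neg]
      rw [ibp_lap hψ2 hw2 hψc]
    rw [e]
    refine integral_mono ?_ ?_ ?_
    · exact (hw2.continuous.mul (lap_continuous hψ2).neg).integrable_of_hasCompactSupport
        (lap_compact hψc).neg.mul_left
    · exact ((hIntg.const_mul _).add ((integrable_indicator_iff measurableSet_closedBall).2
        (integrableOn_const (measure_closedBall_lt_top.ne)))).add
        ((integrable_indicator_iff measurableSet_closedBall).2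
        (integrableOn_const (measure_closedBall_lt_top.ne)))
    · intro x
      have := hA x
      have := hB x
      simp only [hlapψ]
      linarith
  rw [integral_add, integral_add, integral_const_mul, integral_indicator measurableSet_closedBall,
    integral_indicator measurableSet_closedBall, setIntegral_const, setIntegral_const] at hmain
  rotate_left
  · exact hIntg.const_mul _
  · exact (integrable_indicator_iff measurableSet_closedBall).2
        (integrableOn_const (measure_closedBall_lt_top.ne))
  · exact ((hIntg.const_mul _).add ((integrable_indicator_iff measurableSet_closedBall).2
        (integrableOn_const (measure_closedBall_lt_top.ne))))
  · exact (integrable_indicator_iff measurableSet_closedBall).2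
        (integrableOn_const (measure_closedBall_lt_top.ne))
  simp only [smul_eq_mul] at hmain
  set s : Set (EuclideanSpace ℝ (Fin N)) := Metric.ball 0 R \ closedBall 0 (2 * ε) with hs
  have hsm : MeasurableSet s := measurableSet_ball.diff measurableSet_closedBall
  have hmem : ∀ x ∈ s, ‖x‖ < R ∧ 2 * ε < ‖x‖ := by
    intro x hx
    simpa [hs] using hx
  have hcongr : ∀ x ∈ s, V x * u x ^ p = ψ x * (-lap w x) := by
    intro x hx
    obtain ⟨h1, h2⟩ := hmem x hx
    rw [hwlap' x (by linarith)]
    simp [hψ, hΦin x h1.le, hχεout x h2]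
  refine ⟨?_, ?_, ?_⟩
  · have h1 : IntegrableOn w (closedBall 0 R) :=
      hw2.continuous.continuousOn.integrableOn_compact (isCompact_closedBall _ _)
    have h2 : IntegrableOn w s := h1.mono_set (sdiff_subset.trans ball_subset_closedBall)
    exact h2.congr_fun (fun x hx => hwu x (by have := hmem x hx; linarith [this.2])) hsm
  · exact hIntg.integrableOn.congr_fun (fun x hx => (hcongr x hx).symm) hsm
  · rw [setIntegral_congr_fun hsm hcongr]
    have := setIntegral_le_integral (s := s) hIntg (ae_of_all _ hnn)
    linarith

/-- Lemma 4.2, uniform local integral bounds for the family of fast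
decaying solutions. -/
theorem statement_17 (N : ℕ) (hN : 3 ≤ N) (p : ℝ)
    (hp : p ∈ Set.Ioo ((N:ℝ) / ((N:ℝ) - 2)) (pc N))
    (V : EuclideanSpace ℝ (Fin N) → ℝ)
    (hVreg : LocHolderOn V {0}ᶜ)
    (hVnonneg : ∀ x : EuclideanSpace ℝ (Fin N), x ≠ 0 → 0 ≤ V x)
    (hVle1 : ∀ x : EuclideanSpace ℝ (Fin N), x ≠ 0 → V x ≤ 1)
    (c₀ τ₀ : ℝ) (hc₀ : 0 < c₀) (hτ₀ : 0 < τ₀)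
    (hVnear : ∀ x : EuclideanSpace ℝ (Fin N), x ≠ 0 → ‖x‖ ≤ 1 →
      |V x - 1| ≤ c₀ * ‖x‖ ^ τ₀)
    (hVrad : ∀ x y : EuclideanSpace ℝ (Fin N), x ≠ 0 → ‖x‖ = ‖y‖ → V x = V y)
    (hVdecr : ∀ x y : EuclideanSpace ℝ (Fin N), x ≠ 0 → ‖x‖ ≤ ‖y‖ → V y ≤ V x)
    (γ α : ℝ) (hγ : 1 < γ) (hα : ((N:ℝ) - 2) * pc N - N - 2 < α) (hα' : α ≤ 0)
    (hVinf : ∀ x : EuclideanSpace ℝ (Fin N), 1 < ‖x‖ →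
      (1/γ) * ‖x‖ ^ α ≤ V x ∧ V x ≤ γ * ‖x‖ ^ α) :
    ∀ R : ℝ, 0 < R → ∃ c : ℝ, 0 < c ∧
      ∀ ν : ℝ, 0 < ν → ∀ u : EuclideanSpace ℝ (Fin N) → ℝ,
        FastDecaySol N p V u ν → SingAtOrigin N p u →
        (∫ x in Metric.ball (0 : EuclideanSpace ℝ (Fin N)) R, u x ≤ c) ∧
        (∫ x in Metric.ball (0 : EuclideanSpace ℝ (Fin N)) R, V x * u x ^ p ≤ c) := by
  intro R hR
  obtain ⟨hp1, -⟩ := hp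
  have hN' : (3:ℝ) ≤ N := by exact_mod_cast hN
  have hN2 : (0:ℝ) < (N:ℝ) - 2 := by linarith
  have hpN : (N:ℝ) < p * ((N:ℝ) - 2) := (div_lt_iff₀ hN2).1 hp1
  have hp : 1 < p := by nlinarith
  have ha : 2 / (p - 1) < (N:ℝ) - 2 := by
    rw [div_lt_iff₀ (by linarith)]; nlinarith
  set a := 2 / (p - 1) with hadef
  have ha0 : 0 < a := div_pos two_pos (by linarith)
  -- lower bound on `V`
  obtain ⟨κ, hκ, hVκ⟩ : ∃ κ : ℝ, 0 < κ ∧ ∀ x : EuclideanSpace ℝ (Fin N), x ≠ 0 →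
      ‖x‖ ≤ 2 * R → κ ≤ V x := by
    set ρ := max (2 * R) 2 with hρ
    have hρ2 : 2 ≤ ρ := le_max_right _ _
    set y : EuclideanSpace ℝ (Fin N) := EuclideanSpace.single ⟨0, by omega⟩ ρ with hy
    have hyn : ‖y‖ = ρ := by
      rw [hy, EuclideanSpace.norm_single, Real.norm_of_nonneg (by linarith)]
    refine ⟨(1 / γ) * ρ ^ α, by positivity, fun x hx hxR => ?_⟩
    have h1 := (hVinf y (by rw [hyn]; linarith)).1
    rw [hyn] at h1
    exact h1.trans (hVdecr x y hx (by rw [hyn]; exact hxR.trans (le_max_left _ _)))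
  let φ : ContDiffBump (0 : EuclideanSpace ℝ (Fin N)) := ⟨R, 2 * R, hR, by linarith⟩
  let χ : ContDiffBump (0 : EuclideanSpace ℝ (Fin N)) := ⟨1, 2, one_pos, by norm_num⟩
  have hφ2 : ContDiff ℝ 2 φ := φ.contDiff
  have hχ2 : ContDiff ℝ 2 χ := χ.contDiff
  obtain ⟨k, hk⟩ : ∃ k : ℕ, (k:ℝ) + 2 ≤ p * k := by
    obtain ⟨k, hk⟩ := exists_nat_ge (2 / (p - 1))
    refine ⟨k, ?_⟩
    rw [div_le_iff₀ (by linarith)] at hk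
    linarith
  obtain ⟨M, hM, hlap⟩ := lap_pow_bound hφ2 φ.hasCompactSupport (fun x => φ.nonneg) k
  obtain ⟨Mχ, hMχ, hχlap⟩ : ∃ M : ℝ, 0 < M ∧ ∀ x, |lap χ x| ≤ M := by
    obtain ⟨M, hM⟩ := (lap_continuous hχ2).bounded_above_of_compact_support
      (lap_compact χ.hasCompactSupport)
    refine ⟨|M| + 1, by positivity, fun x => ?_⟩
    have := hM x
    rw [Real.norm_eq_abs] at this
    linarith [le_abs_self M]
  obtain ⟨C, hC, hyoung⟩ := young_aux p M (κ / 2) hp hM (half_pos hκ)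
  set B := volume.real (closedBall (0 : EuclideanSpace ℝ (Fin N)) (2 * R)) with hB
  have hB0 : 0 ≤ B := measureReal_nonneg
  set D := 2 * (C * B + 1) with hD
  have hD0 : 0 < D := by positivity
  refine ⟨D + (B + D / κ), by positivity, ?_⟩
  rintro ν - u ⟨hu, hup, heq, -⟩ hsing
  set K := cp N p + 1 with hK
  have hK0 : 0 < K := by
    have : 0 ≤ cp N p := Real.rpow_nonneg (mul_nonneg ha0.le (by linarith)) _
    linarith
  obtain ⟨δ, hδ, hδu⟩ : ∃ δ > 0, ∀ x : EuclideanSpace ℝ (Fin N), x ≠ 0 → ‖x‖ < δ →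
      u x * ‖x‖ ^ a ≤ K := by
    have h1 : ∀ᶠ x in nhdsWithin (0 : EuclideanSpace ℝ (Fin N)) {0}ᶜ, u x * ‖x‖ ^ a < K :=
      hsing.eventually (gt_mem_nhds (by linarith))
    rw [eventually_nhdsWithin_iff, Metric.eventually_nhds_iff] at h1
    obtain ⟨δ, hδ, h⟩ := h1
    exact ⟨δ, hδ, fun x hx hx' => (h (by simpa using hx') hx).le⟩
  set ω := volume.real (Metric.ball (0 : EuclideanSpace ℝ (Fin N)) 1) with hω
  have herr : ∀ ε : ℝ, 0 < ε → (K * ε ^ (-a)) * (Mχ * ε⁻¹ ^ 2) *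
      volume.real (closedBall (0 : EuclideanSpace ℝ (Fin N)) (2 * ε)) =
      (K * Mχ * 2 ^ N * ω) * ε ^ ((N:ℝ) - 2 - a) := by
    intro ε hε
    rw [Measure.addHaar_real_closedBall _ _ (by positivity), finrank_euclideanSpace,
      Fintype.card_fin]
    have e1 : ε ^ ((N:ℝ) - 2 - a) = ε ^ N * ε⁻¹ ^ 2 * ε ^ (-a) := by
      rw [sub_eq_add_neg, Real.rpow_add hε, Real.rpow_sub hε, Real.rpow_natCast, Real.rpow_two,
        inv_pow, div_eq_mul_inv]
    rw [e1, mul_pow]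
    ring
  have herr0 : Tendsto (fun ε : ℝ => (K * Mχ * 2 ^ N * ω) * ε ^ ((N:ℝ) - 2 - a))
      (nhdsWithin 0 (Ioi 0)) (nhds 0) := by
    have h1 : ContinuousAt (fun ε : ℝ => (K * Mχ * 2 ^ N * ω) * ε ^ ((N:ℝ) - 2 - a)) 0 :=
      (Real.continuousAt_rpow_const _ _ (Or.inr (by linarith))).const_mul _
    have h2 := h1.tendsto
    rw [Real.zero_rpow (by linarith), mul_zero] at h2
    exact h2.mono_left nhdsWithin_le_nhds
  have hsmall : ∀ r : ℝ, 0 < r → ∀ᶠ ε in nhdsWithin (0:ℝ) (Ioi 0), ε < r := fun r hr =>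
    (gt_mem_nhds hr : ∀ᶠ ε in nhds (0:ℝ), ε < r).filter_mono nhdsWithin_le_nhds
  have key : ∀ᶠ ε in nhdsWithin (0:ℝ) (Ioi 0),
      IntegrableOn u (Metric.ball 0 R \ closedBall 0 (2 * ε)) ∧
      IntegrableOn (fun x => V x * u x ^ p) (Metric.ball 0 R \ closedBall 0 (2 * ε)) ∧
      ∫ x in Metric.ball 0 R \ closedBall 0 (2 * ε), V x * u x ^ p ≤ D := by
    filter_upwards [self_mem_nhdsWithin, hsmall (R / 2) (by positivity),
      hsmall (δ / 2) (by positivity), herr0.eventually (gt_mem_nhds (one_pos : (0:ℝ) < 1))]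
      with ε hε h1 h2 h3
    have hε : 0 < ε := hε
    have hc := core p R κ M C (K * ε ^ (-a)) Mχ ε k V u φ χ hp hR hC hM hMχ (by positivity)
      hφ2 φ.tsupport_eq.subset
      (fun x hx => φ.one_of_mem_closedBall (by simpa using hx))
      (fun x => φ.nonneg) (fun x => φ.le_one) hlap hk hyoung hχ2 χ.tsupport_eq.subset
      (fun x hx => χ.one_of_mem_closedBall (by simpa using hx))
      (fun x => χ.nonneg) (fun x => χ.le_one) hχlap hVκ hVnonneg hu hup heq hε (by linarith)
      (by
        intro x hx1 hx2
        have hxp : 0 < ‖x‖ := hε.trans_le hx1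
        have hx0 : x ≠ 0 := norm_pos_iff.1 hxp
        have h := hδu x hx0 (by linarith)
        have h4 : ε ^ a ≤ ‖x‖ ^ a := Real.rpow_le_rpow hε.le hx1 ha0.le
        have h5 : u x * ε ^ a ≤ K :=
          (mul_le_mul_of_nonneg_left h4 (hup x hx0).le).trans h
        rw [Real.rpow_neg hε.le, ← div_eq_mul_inv, le_div_iff₀ (by positivity)]
        exact h5)
    refine ⟨hc.1, hc.2.1, hc.2.2.trans ?_⟩
    rw [herr ε hε]
    linarith
  have hDκ : 0 ≤ D / κ := by positivity
  constructor
  · refine limit_aux hN u R _ (by positivity) ?_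
    filter_upwards [key, self_mem_nhdsWithin] with ε ⟨k1, k2, k3⟩ hε
    have hε : 0 < ε := hε
    set s : Set (EuclideanSpace ℝ (Fin N)) := Metric.ball 0 R \ closedBall 0 (2 * ε) with hs
    have hsm : MeasurableSet s := measurableSet_ball.diff measurableSet_closedBall
    have hsub : s ⊆ closedBall 0 (2 * R) :=
      sdiff_subset.trans (ball_subset_closedBall.trans (closedBall_subset_closedBall (by linarith)))
    have hfin : volume s ≠ ⊤ := ((measure_mono hsub).trans_lt measure_closedBall_lt_top).ne
    have h1 : ∫ x in s, u x ≤ ∫ x in s, (1 + κ⁻¹ * (V x * u x ^ p)) := by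
      refine setIntegral_mono_on k1 ((integrableOn_const hfin).add (k2.const_mul _)) hsm ?_
      intro x hx
      have hx' := hsub hx
      rw [mem_closedBall, dist_zero_right] at hx'
      have hx2 : 2 * ε < ‖x‖ := by simpa using hx.2
      have hx0 : x ≠ 0 := norm_pos_iff.1 (by linarith)
      have hux := hup x hx0
      have e1 : u x ≤ 1 + u x ^ p := by
        have hpn : 0 ≤ u x ^ p := Real.rpow_nonneg hux.le _
        rcases le_total (u x) 1 with h | h
        · linarith
        · have := Real.rpow_le_rpow_of_exponent_le h hp.le
          rw [Real.rpow_one] at this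
          linarith
      have e2 : u x ^ p ≤ κ⁻¹ * (V x * u x ^ p) := by
        rw [inv_mul_eq_div, le_div_iff₀ hκ, mul_comm]
        exact mul_le_mul_of_nonneg_right (hVκ x hx0 hx') (Real.rpow_nonneg hux.le _)
      linarith
    have hone : Integrable (fun _ : EuclideanSpace ℝ (Fin N) => (1:ℝ)) (volume.restrict s) :=
      integrableOn_const hfin
    have hk2 : Integrable (fun x => κ⁻¹ * (V x * u x ^ p)) (volume.restrict s) := k2.const_mul _
    rw [integral_add hone hk2, integral_const_mul,
      setIntegral_const, smul_eq_mul, mul_one] at h1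
    have h2 : volume.real s ≤ B := measureReal_mono hsub measure_closedBall_lt_top.ne
    have h3 : κ⁻¹ * ∫ x in s, V x * u x ^ p ≤ D / κ := by
      rw [inv_mul_eq_div]; gcongr
    linarith
  · refine limit_aux hN _ R _ (by positivity) ?_
    filter_upwards [key] with ε hε
    linarith [hε.2.2]
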